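/- For every integer n ≥ 2, there exists a proper colouring of the Mycielskian μ(F_{n+1}) of the friendship graph F_{n+1} using the four colours 1, 2, 3, 4 whose colouring mean equals (7n+14)/(4n+6) when n is even and (7n+13)/(4n+6) when n is odd, and whose colouring variance equals (11n²+62n+56)/(4n+6)² when n is even and (11n²+56n+53)/(4n+6)² when n is odd. -/

import Mathlib

open Finset

/-- The Mycielskian of a graph `G` on vertex set `V`: vertices are
`V ⊕ V ⊕ Unit` where `Sum.inl a` is the original vertex `v_a`,
`Sum.inr (Sum.inl a)` is the shadow vertex `u_a`, and `Sum.inr (Sum.inr ())`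
is the apex vertex `u`. -/
def mycielskian {V : Type*} (G : SimpleGraph V) : SimpleGraph (V ⊕ V ⊕ Unit) :=
  SimpleGraph.fromRel (fun x y =>
    match x, y with
    | Sum.inl a, Sum.inl b => G.Adj a b
    | Sum.inl a, Sum.inr (Sum.inl b) => G.Adj a b
    | Sum.inr (Sum.inl _), Sum.inr (Sum.inr _) => True
    | _, _ => False)

/-- `colClass c i` is the number of vertices receiving colour `i`. -/
def colClass {V : Type*} [Fintype V] (c : V → ℕ) (i : ℕ) : ℕ :=
  (Finset.univ.filter (fun v => c v = i)).card

/-- The colouring mean of a colouring `c` using colours `1, …, k`. -/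
def colMean {V : Type*} [Fintype V] (c : V → ℕ) (k : ℕ) : ℚ :=
  (∑ i ∈ Finset.Icc 1 k, (i : ℚ) * (colClass c i)) / (Fintype.card V : ℚ)

/-- The colouring variance of a colouring `c` using colours `1, …, k`. -/
def colVar {V : Type*} [Fintype V] (c : V → ℕ) (k : ℕ) : ℚ :=
  (∑ i ∈ Finset.Icc 1 k, (i : ℚ) ^ 2 * (colClass c i)) / (Fintype.card V : ℚ)
    - (colMean c k) ^ 2

/-- The path graph `P_n` on `Fin n`. -/
def pathG (n : ℕ) : SimpleGraph (Fin n) :=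
  SimpleGraph.fromRel (fun i j => (i : ℕ) + 1 = (j : ℕ))

/-- The friendship graph $F_{n+1}$ (as defined in the paper): the path $P_n$
on `Fin n` together with a central vertex `Sum.inr ()` adjacent to all path
vertices. -/
def friendshipG (n : ℕ) : SimpleGraph (Fin n ⊕ Unit) :=
  SimpleGraph.fromRel (fun x y =>
    match x, y with
    | Sum.inl i, Sum.inl j => (i : ℕ) + 1 = (j : ℕ)
    | Sum.inl _, Sum.inr _ => True
    | _, _ => False)

/-- Summing over colour classes is the same as summing over vertices. -/
theorem sum_mul_colClass {V : Type*} [Fintype V] (c : V → ℕ) (k : ℕ)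
    (hc : ∀ v, c v ∈ Finset.Icc 1 k) (f : ℕ → ℚ) :
    ∑ i ∈ Finset.Icc 1 k, f i * (colClass c i : ℚ) = ∑ v, f (c v) := by
  rw [← Finset.sum_fiberwise_of_maps_to (fun v _ => hc v)]
  refine Finset.sum_congr rfl fun i _ => ?_
  rw [Finset.sum_congr rfl fun v hv => congrArg f (Finset.mem_filter.mp hv).2,
    Finset.sum_const, nsmul_eq_mul, mul_comm, colClass]

/-- A proper 4-colouring: the path alternates between `2` and `3`, the shadows of the path and
of the centre get `1`, the centre gets `4` and the apex gets `2`. -/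
def mycielskianFriendshipColouring (n : ℕ) : (Fin n ⊕ Unit) ⊕ (Fin n ⊕ Unit) ⊕ Unit → ℕ
  | Sum.inl (Sum.inl i) => 2 + (i : ℕ) % 2
  | Sum.inl (Sum.inr _) => 4
  | Sum.inr (Sum.inl _) => 1
  | Sum.inr (Sum.inr _) => 2

theorem mycielskianFriendshipColouring_mem (n : ℕ) (v) :
    mycielskianFriendshipColouring n v ∈ Finset.Icc 1 4 := by
  rcases v with (i | _) | (i | _) | _ <;>
    simp only [mycielskianFriendshipColouring, Finset.mem_Icc] <;> omega

theorem mycielskianFriendshipColouring_proper (n : ℕ) (x y)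
    (h : (mycielskian (friendshipG n)).Adj x y) :
    mycielskianFriendshipColouring n x ≠ mycielskianFriendshipColouring n y := by
  rcases x with (i | _) | (i | _) | _ <;> rcases y with (j | _) | (j | _) | _ <;>
    simp [mycielskian, friendshipG, mycielskianFriendshipColouring] at h ⊢ <;> omega

theorem sum_mycielskianFriendshipColouring (n : ℕ) (f : ℕ → ℚ) :
    ∑ v, f (mycielskianFriendshipColouring n v) =
      ∑ i ∈ Finset.range n, f (2 + i % 2) + n * f 1 + (f 1 + f 2 + f 4) := by
  simp only [Fintype.sum_sum_type, mycielskianFriendshipColouring, Finset.sum_const,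
    Finset.card_univ, Fintype.card_sum, Fintype.card_fin, Fintype.card_unit, nsmul_eq_mul,
    Fin.sum_univ_eq_sum_range (fun i => f (2 + i % 2))]
  push_cast
  ring

theorem sum_range_two_mul_alternating (m : ℕ) (f : ℕ → ℚ) :
    ∑ i ∈ Finset.range (2 * m), f (2 + i % 2) = m * (f 2 + f 3) := by
  induction m with
  | zero => simp
  | succ m ih =>
    rw [Nat.mul_succ, Finset.sum_range_succ, Finset.sum_range_succ, ih,
      show 2 * m % 2 = 0 by omega, show (2 * m + 1) % 2 = 1 by omega]
    push_cast
    ring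

theorem sum_range_two_mul_add_one_alternating (m : ℕ) (f : ℕ → ℚ) :
    ∑ i ∈ Finset.range (2 * m + 1), f (2 + i % 2) = m * (f 2 + f 3) + f 2 := by
  rw [Finset.sum_range_succ, sum_range_two_mul_alternating, show 2 * m % 2 = 0 by omega]

theorem sum_mul_colClass_mycielskianFriendshipColouring (n : ℕ) (f : ℕ → ℚ) :
    ∑ i ∈ Finset.Icc 1 4, f i * (colClass (mycielskianFriendshipColouring n) i : ℚ) =
      ∑ i ∈ Finset.range n, f (2 + i % 2) + n * f 1 + (f 1 + f 2 + f 4) := by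
  rw [sum_mul_colClass _ _ (mycielskianFriendshipColouring_mem n),
    sum_mycielskianFriendshipColouring]

theorem card_mycielskian_friendship (n : ℕ) :
    (Fintype.card ((Fin n ⊕ Unit) ⊕ (Fin n ⊕ Unit) ⊕ Unit) : ℚ) = 2 * n + 3 := by
  simp only [Fintype.card_sum, Fintype.card_fin, Fintype.card_unit]
  push_cast
  ring

/-- The $χ$-chromatic mean and variance of the Mycielskian of the friendship
graph $F_{n+1}$. -/
theorem chi_chromatic_parameters_mycielskian_friendship (n : ℕ) (hn : 2 ≤ n) :
    ∃ c : ((Fin n ⊕ Unit) ⊕ (Fin n ⊕ Unit) ⊕ Unit) → ℕ,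
      (∀ v, c v ∈ Finset.Icc 1 4) ∧
      (∀ x y, (mycielskian (friendshipG n)).Adj x y → c x ≠ c y) ∧
      (Even n →
        colMean c 4 = (7 * (n : ℚ) + 14) / (4 * (n : ℚ) + 6) ∧
        colVar c 4 = (11 * (n : ℚ) ^ 2 + 62 * (n : ℚ) + 56) / (4 * (n : ℚ) + 6) ^ 2) ∧
      (Odd n →
        colMean c 4 = (7 * (n : ℚ) + 13) / (4 * (n : ℚ) + 6) ∧
        colVar c 4 = (11 * (n : ℚ) ^ 2 + 56 * (n : ℚ) + 53) / (4 * (n : ℚ) + 6) ^ 2) := by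
  refine ⟨mycielskianFriendshipColouring n, mycielskianFriendshipColouring_mem n,
    mycielskianFriendshipColouring_proper n, fun h => ?_, fun h => ?_⟩
  · obtain ⟨m, rfl⟩ := h.two_dvd
    rw [colVar, colMean, card_mycielskian_friendship,
      sum_mul_colClass_mycielskianFriendshipColouring _ (fun i => (i : ℚ)),
      sum_mul_colClass_mycielskianFriendshipColouring _ (fun i => (i : ℚ) ^ 2),
      sum_range_two_mul_alternating _ (fun i => (i : ℚ)),
      sum_range_two_mul_alternating _ (fun i => (i : ℚ) ^ 2)]
    push_cast
    constructor <;> field_simp <;> ring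
  · obtain ⟨m, rfl⟩ := h
    rw [colVar, colMean, card_mycielskian_friendship,
      sum_mul_colClass_mycielskianFriendshipColouring _ (fun i => (i : ℚ)),
      sum_mul_colClass_mycielskianFriendshipColouring _ (fun i => (i : ℚ) ^ 2),
      sum_range_two_mul_add_one_alternating _ (fun i => (i : ℚ)),
      sum_range_two_mul_add_one_alternating _ (fun i => (i : ℚ) ^ 2)]
    push_cast
    constructor <;> field_simp <;> ring
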